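/- arXiv:1701.07579 — 5 statements merged into one kernel-verified Lean document; each statement's English description precedes it below -/
import Mathlib

section
/- Let C be a linear code of length n and dimension k over a finite field, let i ∈ {1,…,k}, and let R_1, R_2, …, R_t ⊆ {1,…,n} be pairwise disjoint recovery sets for the information coordinate i. Then there exist indices a_2 ∈ R_2, a_3 ∈ R_3, …, a_t ∈ R_t such that for any two codewords y = C(x) and y' = C(x') that agree on all coordinates in R_1 and on all coordinates in R_j \ {a_j} for every j ∈ {2,…,t}, y and y' also agree on all the coordinates a_2, a_3, …, a_t. -/
/-- `R` is a recovery set for information coordinate `i` of the linear encoding `C`: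
the value `x i` is determined by the restriction of the codeword `C x` to `R`. -/
def IsRecoverySet {F : Type} [Field F] {k : ℕ} {ι : Type}
    (C : (Fin k → F) →ₗ[F] (ι → F)) (i : Fin k) (R : Finset ι) : Prop :=
  ∀ x x' : Fin k → F, (∀ j ∈ R, C x j = C x' j) → x i = x' i

/-- A recovery set `R` for `i` contains a coordinate `a` which is determined by `x i` together with
the remaining coordinates in `R`. -/
theorem IsRecoverySet.exists_determined_coordinate {F : Type} [Field F] {k : ℕ} {ι : Type}
    [DecidableEq ι] {C : (Fin k → F) →ₗ[F] (ι → F)} {i : Fin k} {R : Finset ι}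
    (hR : IsRecoverySet C i R) :
    ∃ a ∈ R, ∀ x x' : Fin k → F, x i = x' i → (∀ j ∈ R \ {a}, C x j = C x' j) →
      C x a = C x' a := by
  by_contra! h
  have hz : ∀ a, ∃ z : Fin k → F, a ∈ R →
      z i = 0 ∧ (∀ j ∈ R, j ≠ a → C z j = 0) ∧ C z a ≠ 0 := by
    intro a
    by_cases ha : a ∈ R
    · obtain ⟨x, x', hi, hj, hne⟩ := h a ha
      refine ⟨x - x', fun _ => ⟨by simp [hi], fun j hjR hja => ?_, ?_⟩⟩
      · simp [hj j (by simp [hjR, hja])]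
      · simpa [sub_eq_zero] using hne
    · exact ⟨0, fun h' => absurd h' ha⟩
  choose z hz using hz
  let e : Fin k → F := Pi.single i 1
  let w : Fin k → F := ∑ a ∈ R, (C e a / C (z a) a) • z a
  have hw : w i = 0 := by
    simp only [w, Finset.sum_apply, Pi.smul_apply]
    exact Finset.sum_eq_zero fun a ha => by simp [(hz a ha).1]
  have hew : e i = w i := by
    refine hR e w fun j hj => ?_
    simp only [w, map_sum, map_smul, Finset.sum_apply, Pi.smul_apply, smul_eq_mul]
    rw [Finset.sum_eq_single_of_mem j hj
      fun a ha haj => by rw [(hz a ha).2.1 j hj haj.symm, mul_zero]]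
    exact (div_mul_cancel₀ _ (hz j hj).2.2).symm
  simp [hw, e] at hew

/-- If `R 0, R 1, …, R (t-1)` are pairwise disjoint recovery sets for the information
coordinate `i` of a linear code `C`, then there exist indices `a l ∈ R l` (for `l ≠ 0`)
such that any two codewords agreeing on `R 0` and on each `R l \ {a l}` (`l ≠ 0`)
also agree on every coordinate `a l`. -/
theorem batch_fixed_coordinates {F : Type} [Field F] [Fintype F] {n k t : ℕ} (ht : 0 < t)
    (C : (Fin k → F) →ₗ[F] (Fin n → F)) (hinj : Function.Injective C)
    (i : Fin k) (R : Fin t → Finset (Fin n))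
    (hdisj : ∀ l₁ l₂ : Fin t, l₁ ≠ l₂ → Disjoint (R l₁) (R l₂))
    (hrec : ∀ l : Fin t, IsRecoverySet C i (R l)) :
    ∃ a : Fin t → Fin n,
      (∀ l : Fin t, l ≠ ⟨0, ht⟩ → a l ∈ R l) ∧
      ∀ x x' : Fin k → F,
        (∀ j ∈ R ⟨0, ht⟩, C x j = C x' j) →
        (∀ l : Fin t, l ≠ ⟨0, ht⟩ → ∀ j ∈ R l \ {a l}, C x j = C x' j) →
        ∀ l : Fin t, l ≠ ⟨0, ht⟩ → C x (a l) = C x' (a l) := by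
  choose a ha hdet using fun l => (hrec l).exists_determined_coordinate
  exact ⟨a, fun l _ => ha l, fun x x' h₀ h l hl =>
    hdet l x x' (hrec ⟨0, ht⟩ x x' h₀) (h l hl)⟩
end

section
/- For every k ≥ 1 and every r ≥ 2, B(k,r,2) = P(k,r,2) = ⌈k/r⌉ + k; that is, the smallest length of a systematic linear binary (n,k,r,2) batch code and the smallest length of a systematic linear binary (n,k,r,2) PIR code are both equal to ⌈k/r⌉ + k. -/
/-- `C` is an `(n,k,r,t)` batch code: every query of `t` (possibly repeated) information
coordinates is served by `t` pairwise disjoint recovery sets, each of size at most `r`. -/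
def IsBatchCode {F : Type} [Field F] {k : ℕ} {ι : Type} (r t : ℕ)
    (C : (Fin k → F) →ₗ[F] (ι → F)) : Prop :=
  Function.Injective C ∧
    ∀ q : Fin t → Fin k, ∃ R : Fin t → Finset ι,
      (∀ l₁ l₂ : Fin t, l₁ ≠ l₂ → Disjoint (R l₁) (R l₂)) ∧
      (∀ l : Fin t, (R l).card ≤ r) ∧
      (∀ l : Fin t, IsRecoverySet C (q l) (R l))

/-- `C` is an `(n,k,r,t)` PIR code: every query `(x_i, …, x_i)` of size `t` is served by
`t` pairwise disjoint recovery sets for `i`, each of size at most `r`. -/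
def IsPIRCode {F : Type} [Field F] {k : ℕ} {ι : Type} (r t : ℕ)
    (C : (Fin k → F) →ₗ[F] (ι → F)) : Prop :=
  Function.Injective C ∧
    ∀ i : Fin k, ∃ R : Fin t → Finset ι,
      (∀ l₁ l₂ : Fin t, l₁ ≠ l₂ → Disjoint (R l₁) (R l₂)) ∧
      (∀ l : Fin t, (R l).card ≤ r) ∧
      (∀ l : Fin t, IsRecoverySet C i (R l))

/-- `C` is systematic: the information vector appears in the first `k` coordinates. -/
def IsSystematic {F : Type} [Field F] {k n : ℕ}
    (C : (Fin k → F) →ₗ[F] (Fin n → F)) : Prop :=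
  ∀ x : Fin k → F, ∀ i : Fin k, ∃ h : (i : ℕ) < n, C x ⟨i, h⟩ = x i

/-- A recovery set for `i` gives a linear combination of the coordinates in it equal to `x i`. -/
theorem IsRecoverySet.exists_coeff {F : Type} [Field F] {k : ℕ} {ι : Type} [Fintype ι]
    {C : (Fin k → F) →ₗ[F] (ι → F)} {i : Fin k} {R : Finset ι} (h : IsRecoverySet C i R) :
    ∃ c : ι → F, (∀ j ∉ R, c j = 0) ∧ ∀ x, ∑ j, c j * C x j = x i := by
  classical
  have hspan := mem_span_of_iInf_ker_le_ker (𝕜 := F)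
    (L := fun j : R => (LinearMap.proj (j : ι) : (ι → F) →ₗ[F] F) ∘ₗ C)
    (K := (LinearMap.proj i : (Fin k → F) →ₗ[F] F)) (by
      intro x hx
      simp only [Submodule.mem_iInf, LinearMap.mem_ker, LinearMap.comp_apply,
        LinearMap.proj_apply] at hx ⊢
      simpa using h x 0 (fun j hj => by simpa using hx ⟨j, hj⟩))
  obtain ⟨c, hc⟩ := (Submodule.mem_span_range_iff_exists_fun F).1 hspan
  refine ⟨fun j => if hj : j ∈ R then c ⟨j, hj⟩ else 0, fun j hj => by simp [hj], fun x => ?_⟩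
  have hx := LinearMap.congr_fun hc x
  simp only [LinearMap.sum_apply, LinearMap.smul_apply, LinearMap.comp_apply,
    LinearMap.proj_apply, smul_eq_mul] at hx
  rw [← hx, ← Finset.sum_subset (Finset.subset_univ R), ← Finset.sum_coe_sort R]
  · exact Finset.sum_congr rfl fun j _ => by simp
  · intro j _ hj
    simp [hj]

/-- The dual code of `C`: all vectors orthogonal to every codeword. -/
def dualCode {F : Type} [Field F] {k : ℕ} {ι : Type} [Fintype ι]
    (C : (Fin k → F) →ₗ[F] (ι → F)) : Submodule F (ι → F) where
  carrier := {w | ∀ x, ∑ j, w j * C x j = 0}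
  add_mem' ha hb x := by simp [add_mul, Finset.sum_add_distrib, ha x, hb x]
  zero_mem' x := by simp
  smul_mem' a w hw x := by simp [mul_assoc, ← Finset.mul_sum, hw x]

/-- A dual codeword of a systematic code vanishes if it vanishes on the parity coordinates. -/
theorem IsSystematic.eq_zero_of_mem_dualCode {F : Type} [Field F] {k m : ℕ}
    {C : (Fin k → F) →ₗ[F] (Fin (k + m) → F)} (hC : IsSystematic C)
    {w : Fin (k + m) → F} (hw : w ∈ dualCode C) (h : ∀ j, w (Fin.natAdd k j) = 0) : w = 0 := by
  have hsys : ∀ x i, C x (Fin.castAdd m i) = x i := fun x i => (hC x i).2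
  funext j
  induction j using Fin.addCases with
  | right j => exact h j
  | left i =>
    have := hw (Pi.single i 1)
    simpa [Fin.sum_univ_add, hsys, h, Pi.single_apply] using this

theorem IsSystematic.finrank_dualCode_le {F : Type} [Field F] {k m : ℕ}
    {C : (Fin k → F) →ₗ[F] (Fin (k + m) → F)} (hC : IsSystematic C) :
    Module.finrank F (dualCode C) ≤ m := by
  have := LinearMap.finrank_le_finrank_of_injective
    (f := LinearMap.funLeft F F (Fin.natAdd k : Fin m → Fin (k + m)) ∘ₗ (dualCode C).subtype) (by
      rw [← LinearMap.ker_eq_bot, LinearMap.ker_eq_bot']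
      intro w hw
      exact Subtype.ext (hC.eq_zero_of_mem_dualCode w.2 fun j => congrFun hw j))
  simpa using this

open Finset in
/-- A recovery set of size at most `r` avoiding the coordinate `i` itself gives a dual codeword
with at most `r` nonzero information coordinates, one of which is `i`. -/
theorem IsSystematic.exists_mem_dualCode {F : Type} [Field F] [DecidableEq F] {k m r : ℕ}
    {C : (Fin k → F) →ₗ[F] (Fin (k + m) → F)} (hC : IsSystematic C) {i : Fin k}
    {R : Finset (Fin (k + m))} (hR : IsRecoverySet C i R) (hcard : #R ≤ r)
    (hi : Fin.castAdd m i ∉ R) :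
    ∃ w ∈ dualCode C, w (Fin.castAdd m i) ≠ 0 ∧
      #{j : Fin k | w (Fin.castAdd m j) ≠ 0} ≤ r := by
  obtain ⟨c, hc0, hc⟩ := hR.exists_coeff
  have hsys : ∀ x i, C x (Fin.castAdd m i) = x i := fun x i => (hC x i).2
  set w : Fin (k + m) → F := c - Pi.single (Fin.castAdd m i) 1 with hw
  have hwi : w (Fin.castAdd m i) ≠ 0 := by simp [hw, hc0 _ hi]
  have hwD : w ∈ dualCode C := by
    intro x
    simp [hw, sub_mul, Finset.sum_sub_distrib, hc, Pi.single_apply, hsys]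
  refine ⟨w, hwD, hwi, ?_⟩
  obtain ⟨p, hp⟩ : ∃ p, w (Fin.natAdd k p) ≠ 0 := by
    by_contra! h
    exact hwi (congrFun (hC.eq_zero_of_mem_dualCode hwD h) _)
  have hsub : insert (Fin.natAdd k p)
      (({j : Fin k | w (Fin.castAdd m j) ≠ 0} : Finset (Fin k)).map (Fin.castAddEmb m)) ⊆
      insert (Fin.castAdd m i) R := by
    have key : ∀ j, w j ≠ 0 → j ∈ insert (Fin.castAdd m i) R := by
      intro j hj
      by_contra h
      rw [Finset.mem_insert, not_or] at h
      exact hj (by simp [hw, hc0 j h.2, h.1])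
    intro j hj
    rw [Finset.mem_insert, Finset.mem_map] at hj
    rcases hj with rfl | ⟨j, hj, rfl⟩
    · exact key _ hp
    · exact key _ (by simpa using hj)
  have hle := Finset.card_le_card hsub
  rw [Finset.card_insert_of_notMem, Finset.card_insert_of_notMem hi, Finset.card_map] at hle
  · omega
  · simp only [Finset.mem_map, not_exists, not_and]
    intro j _ hj
    have := congrArg Fin.val hj
    simp at this
    omega

/-- A systematic PIR code serving two requests with recovery sets of size at most `r` needs
at least `k / r` parity coordinates. -/
theorem IsPIRCode.le_mul_of_isSystematic {F : Type} [Field F] {k m r : ℕ}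
    {C : (Fin k → F) →ₗ[F] (Fin (k + m) → F)} (hC : IsSystematic C) (hP : IsPIRCode r 2 C) :
    k ≤ m * r := by
  classical
  have hex : ∀ i : Fin k, ∃ w : dualCode C, w.1 (Fin.castAdd m i) ≠ 0 ∧
      ({j : Fin k | w.1 (Fin.castAdd m j) ≠ 0} : Finset (Fin k)).card ≤ r := by
    intro i
    obtain ⟨R, hdisj, hcard, hrec⟩ := hP.2 i
    obtain ⟨l, hl⟩ : ∃ l, Fin.castAdd m i ∉ R l := by
      by_contra! h
      exact Finset.disjoint_left.1 (hdisj 0 1 (by decide)) (h 0) (h 1)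
    obtain ⟨w, hwD, hw⟩ := hC.exists_mem_dualCode (hrec l) (hcard l) hl
    exact ⟨⟨w, hwD⟩, hw⟩
  choose w hwi hwr using hex
  obtain ⟨κ, a, ha, hspan, hli⟩ := exists_linearIndependent' F w
  have : Fintype κ := Fintype.ofInjective a ha
  have hκ : Fintype.card κ ≤ m := hli.fintype_card_le_finrank.trans hC.finrank_dualCode_le
  have hcover : (Finset.univ : Finset (Fin k)) ⊆ Finset.univ.biUnion fun b : κ =>
      ({j : Fin k | (w (a b)).1 (Fin.castAdd m j) ≠ 0} : Finset (Fin k)) := by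
    intro i _
    by_contra h
    simp only [Finset.mem_biUnion, Finset.mem_univ, Finset.mem_filter, true_and, not_exists,
      not_not] at h
    have hle : Submodule.span F (Set.range (w ∘ a)) ≤ LinearMap.ker
        ((LinearMap.proj (Fin.castAdd m i) : (Fin (k + m) → F) →ₗ[F] F) ∘ₗ
          (dualCode C).subtype) := by
      rw [Submodule.span_le]
      rintro _ ⟨b, rfl⟩
      exact h b
    rw [hspan] at hle
    exact hwi i (hle (Submodule.subset_span ⟨i, rfl⟩))
  calc k = (Finset.univ : Finset (Fin k)).card := by simp
    _ ≤ _ := Finset.card_le_card hcover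
    _ ≤ Fintype.card κ * r := Finset.card_biUnion_le_card_mul _ _ _ fun b _ => hwr (a b)
    _ ≤ m * r := Nat.mul_le_mul_right r hκ

theorem IsSystematic.injective {F : Type} [Field F] {k n : ℕ}
    {C : (Fin k → F) →ₗ[F] (Fin n → F)} (hC : IsSystematic C) : Function.Injective C := by
  intro x y hxy
  funext i
  obtain ⟨hi, hx⟩ := hC x i
  rw [← hx, hxy, (hC y i).2]

theorem IsBatchCode.isPIRCode {F : Type} [Field F] {k r t : ℕ} {ι : Type}
    {C : (Fin k → F) →ₗ[F] (ι → F)} (hC : IsBatchCode r t C) : IsPIRCode r t C :=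
  ⟨hC.1, fun i => hC.2 fun _ => i⟩

/-- The systematic code whose parity coordinate `k + a` is the sum of the `a`-th block of `r`
consecutive information coordinates. -/
def blockParityCode (F : Type) [Field F] (k r n : ℕ) : (Fin k → F) →ₗ[F] (Fin n → F) where
  toFun x j := if h : (j : ℕ) < k then x ⟨j, h⟩ else
    ∑ i ∈ Finset.univ.filter (fun i : Fin k => (i : ℕ) / r = (j : ℕ) - k), x i
  map_add' x y := by
    funext j
    by_cases h : (j : ℕ) < k <;> simp [h, Finset.sum_add_distrib]
  map_smul' c x := by
    funext j
    by_cases h : (j : ℕ) < k <;> simp [h, Finset.mul_sum]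

theorem card_filter_div_eq_le {k r a : ℕ} (hr : 0 < r) :
    (Finset.univ.filter fun i : Fin k => (i : ℕ) / r = a).card ≤ r := by
  calc _ ≤ (Finset.Ico (a * r) (a * r + r)).card := by
        refine Finset.card_le_card_of_injOn Fin.val ?_ Fin.val_injective.injOn
        intro i hi
        have hi : (i : ℕ) / r = a := by simpa using hi
        rw [Nat.div_eq_iff hr] at hi
        simp only [Finset.coe_Ico, Set.mem_Ico]
        omega
    _ = r := by simp

theorem blockParityCode_isSystematic (F : Type) [Field F] {k r n : ℕ} (hn : k ≤ n) :
    IsSystematic (blockParityCode F k r n) :=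
  fun x i => ⟨i.2.trans_le hn, by simp [blockParityCode]⟩

theorem blockParityCode_isBatchCode (F : Type) [Field F] {k r : ℕ} (hr : 0 < r) :
    IsBatchCode r 2 (blockParityCode F k r ((k + r - 1) / r + k)) := by
  classical
  set n := (k + r - 1) / r + k with hn
  have hkn : k ≤ n := Nat.le_add_left _ _
  have hval : ∀ x (i : Fin k), blockParityCode F k r n x (Fin.castLE hkn i) = x i :=
    fun x i => by simp [blockParityCode]
  have hself : ∀ i, IsRecoverySet (blockParityCode F k r n) i {Fin.castLE hkn i} := by
    intro i x x' h
    simpa only [hval] using h _ (Finset.mem_singleton_self _)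
  refine ⟨(blockParityCode_isSystematic F hkn).injective, fun q => ?_⟩
  by_cases hq : q 0 = q 1
  · set i := q 0 with hi
    have hp : (i : ℕ) / r + k < n := by
      have : (i : ℕ) / r < (k + r - 1) / r := by
        rw [Nat.lt_iff_add_one_le, ← Nat.add_div_right _ hr]
        exact Nat.div_le_div_right (by omega)
      omega
    set G : Finset (Fin k) := Finset.univ.filter fun j => (j : ℕ) / r = (i : ℕ) / r with hG
    have hiG : i ∈ G := by simp [hG]
    set S : Finset (Fin n) :=
      insert ⟨(i : ℕ) / r + k, hp⟩ ((G.erase i).map (Fin.castLEEmb hkn)) with hS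
    have hScard : S.card ≤ r := by
      have h1 := Finset.card_insert_le (⟨(i : ℕ) / r + k, hp⟩ : Fin n)
        ((G.erase i).map (Fin.castLEEmb hkn))
      have h2 := Finset.card_pos.2 ⟨i, hiG⟩
      have h3 : G.card ≤ r := card_filter_div_eq_le hr
      rw [← hS, Finset.card_map, Finset.card_erase_of_mem hiG] at h1
      omega
    have hdisj : Disjoint {Fin.castLE hkn i} S := by
      rw [Finset.disjoint_singleton_left, hS, Finset.mem_insert, not_or]
      constructor
      · intro h
        have : (i : ℕ) = (i : ℕ) / r + k := congrArg Fin.val h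
        exact absurd i.2 (not_lt.2 ((Nat.le_add_left k _).trans_eq this.symm))
      · simp [Fin.ext_iff]
    have hrec : IsRecoverySet (blockParityCode F k r n) i S := by
      intro x x' h
      have hpar : ∀ y, blockParityCode F k r n y ⟨(i : ℕ) / r + k, hp⟩ = ∑ j ∈ G, y j :=
        fun y => by simp [blockParityCode, hG]
      have h0 := h _ (Finset.mem_insert_self _ _)
      rw [hpar, hpar, ← Finset.add_sum_erase _ _ hiG, ← Finset.add_sum_erase _ _ hiG] at h0
      have h1 : ∑ j ∈ G.erase i, x j = ∑ j ∈ G.erase i, x' j := by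
        refine Finset.sum_congr rfl fun j hj => ?_
        rw [← hval x, ← hval x']
        exact h _ (Finset.mem_insert_of_mem (Finset.mem_map_of_mem (Fin.castLEEmb hkn) hj))
      rw [h1] at h0
      exact add_right_cancel h0
    refine ⟨![{Fin.castLE hkn i}, S], ?_, ?_, ?_⟩
    · simp only [Fin.forall_fin_two]
      exact ⟨⟨fun h => absurd rfl h, fun _ => hdisj⟩, fun _ => hdisj.symm, fun h => absurd rfl h⟩
    · simp only [Fin.forall_fin_two]
      exact ⟨(Finset.card_singleton _).trans_le hr, hScard⟩
    · simp only [Fin.forall_fin_two]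
      exact ⟨hself i, hq ▸ hrec⟩
  · refine ⟨fun l => {Fin.castLE hkn (q l)}, ?_, fun l => (Finset.card_singleton _).trans_le hr, fun l => hself _⟩
    simp [Fin.forall_fin_two, hq, Ne.symm hq]

/-- For `t = 2` and any `r ≥ 2`, the optimal length of systematic linear binary batch
codes and PIR codes is `⌈k/r⌉ + k`. -/
theorem optimal_length_t_two (k r : ℕ) (hk : 1 ≤ k) (hr : 2 ≤ r) :
    IsLeast {n : ℕ | ∃ C : (Fin k → ZMod 2) →ₗ[ZMod 2] (Fin n → ZMod 2),
        IsSystematic C ∧ IsBatchCode r 2 C} ((k + r - 1) / r + k) ∧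
    IsLeast {n : ℕ | ∃ C : (Fin k → ZMod 2) →ₗ[ZMod 2] (Fin n → ZMod 2),
        IsSystematic C ∧ IsPIRCode r 2 C} ((k + r - 1) / r + k) := by
  have hr0 : 0 < r := by omega
  have hsys := blockParityCode_isSystematic (ZMod 2) (r := r) (Nat.le_add_left k ((k + r - 1) / r))
  have hbatch := blockParityCode_isBatchCode (ZMod 2) (k := k) hr0
  have hlower : ∀ n, ∀ C : (Fin k → ZMod 2) →ₗ[ZMod 2] (Fin n → ZMod 2),
      IsSystematic C → IsPIRCode r 2 C → (k + r - 1) / r + k ≤ n := by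
    intro n C hC hP
    obtain ⟨hlt, -⟩ := hC 0 ⟨k - 1, by omega⟩
    obtain ⟨m, rfl⟩ : ∃ m, n = k + m := Nat.exists_eq_add_of_le (by simp at hlt; omega)
    have hle := hP.le_mul_of_isSystematic hC
    have : (k + r - 1) / r < m + 1 := by
      rw [Nat.div_lt_iff_lt_mul hr0, add_mul]
      omega
    omega
  exact ⟨⟨⟨_, hsys, hbatch⟩, fun n ⟨C, hC, hB⟩ => hlower n C hC hB.isPIRCode⟩,
    ⟨⟨_, hsys, hbatch.isPIRCode⟩, fun n ⟨C, hC, hP⟩ => hlower n C hC hP⟩⟩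
end

section
/- Let k ≥ 4, r = 2, and let t satisfy 3 ≤ t ≤ max{⌈k/2⌉, 2} + 2. Then k + t − 2 + ⌈((t−1)(k−1)+1)/t⌉ ≤ P(k,2,t) ≤ k + ⌈(t−1)·k/2⌉. -/
open Module in
/-- Over a field, the coordinate `i` is determined by the coordinates in a recovery set linearly. -/
theorem IsRecoverySet.proj_mem_span {F : Type} [Field F] {k : ℕ} {ι : Type}
    {C : (Fin k → F) →ₗ[F] (ι → F)} {i : Fin k} {R : Finset ι} (h : IsRecoverySet C i R) :
    (LinearMap.proj i : Dual F (Fin k → F)) ∈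
      Submodule.span F ((fun j => (LinearMap.proj j).comp C) '' (R : Set ι)) := by
  have key := mem_span_of_iInf_ker_le_ker
    (L := fun j : R => ((LinearMap.proj (j : ι)).comp C : (Fin k → F) →ₗ[F] F))
    (K := (LinearMap.proj i : (Fin k → F) →ₗ[F] F)) (by
      intro x hx
      simp only [Submodule.mem_iInf, LinearMap.mem_ker, LinearMap.comp_apply,
        LinearMap.proj_apply] at hx ⊢
      exact h x 0 fun j hj => by simpa using hx ⟨j, hj⟩)
  convert key using 2
  ext f
  simp

/-- Adjoining `U` to `W'` increases the rank by less than `#U` if an element of `W' \ W` lies in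
the span of `W` and `U`. -/
theorem finrank_sup_span_image_succ_le {F E ι : Type} [Field F] [AddCommGroup E] [Module F E]
    [FiniteDimensional F E] {W W' : Submodule F E} (hW : W ≤ W') {p : E} (hpW : p ∉ W)
    (hpW' : p ∈ W') (col : ι → E) (U : Finset ι)
    (hpU : p ∈ W ⊔ Submodule.span F (col '' (U : Set ι))) :
    Module.finrank F ↥(W' ⊔ Submodule.span F (col '' (U : Set ι))) + 1 ≤
      Module.finrank F W' + U.card := by
  classical
  set B := Submodule.span F (col '' (U : Set ι)) with hB
  have hBcard : Module.finrank F B ≤ U.card := by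
    have h := finrank_span_finset_le_card (R := F) (U.image col)
    rw [Finset.coe_image] at h
    exact h.trans Finset.card_image_le
  have hsup : W' ⊔ (W ⊔ B) = W' ⊔ B := by
    rw [← sup_assoc, sup_eq_left.mpr hW]
  have h₁ := Submodule.finrank_sup_add_finrank_inf_eq W' (W ⊔ B)
  have h₂ := Submodule.finrank_add_le_finrank_add_finrank W B
  have hlt : W < W' ⊓ (W ⊔ B) :=
    lt_of_le_of_ne (le_inf hW le_sup_left) fun h => hpW (h ▸ ⟨hpW', hpU⟩)
  have h₃ := Submodule.finrank_lt_finrank_of_lt hlt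
  rw [hsup] at h₁
  omega

/-- Adjoining to a subspace `W` a vector `p = col j₀` together with disjoint pairs of columns
whose spans contain `p`. -/
theorem exists_extension_by_recovery_sets {F E ι κ : Type} [Field F] [AddCommGroup E] [Module F E]
    [FiniteDimensional F E] [DecidableEq ι] (W : Submodule F E) (col : ι → E) {j₀ : ι}
    (hj₀ : col j₀ ∉ W) (S : Finset ι) (hS : ∀ j, j ∈ S ↔ col j ∈ W) (R : κ → Finset ι)
    (hdisj : ∀ l₁ l₂, l₁ ≠ l₂ → Disjoint (R l₁) (R l₂)) (hj₀R : ∀ l, j₀ ∉ R l)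
    (hcard : ∀ l, (R l).card ≤ 2)
    (hspan : ∀ l, col j₀ ∈ Submodule.span F (col '' (R l : Set ι))) (A : Finset κ) :
    ∃ W' : Submodule F E, W ≤ W' ∧ (∀ j ∈ insert j₀ (S ∪ A.biUnion R), col j ∈ W') ∧
      Module.finrank F W' ≤ Module.finrank F W + 1 + A.card ∧
      S.card + Module.finrank F W' + A.card ≤
        (insert j₀ (S ∪ A.biUnion R)).card + Module.finrank F W := by
  classical
  induction A using Finset.induction_on with
  | empty =>
    have hj₀S : j₀ ∉ S := fun h => hj₀ ((hS _).1 h)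
    have h := Submodule.finrank_add_le_finrank_add_finrank W (Submodule.span F {col j₀})
    have h' : Module.finrank F (Submodule.span F {col j₀}) ≤ 1 :=
      (finrank_span_le_card (R := F) {col j₀}).trans (by simp)
    refine ⟨W ⊔ Submodule.span F {col j₀}, le_sup_left, ?_, ?_, ?_⟩
    · intro j hj
      simp only [Finset.biUnion_empty, Finset.union_empty, Finset.mem_insert] at hj
      rcases hj with rfl | hj
      · exact Submodule.mem_sup_right (Submodule.mem_span_singleton_self _)
      · exact Submodule.mem_sup_left ((hS j).1 hj)
    · simp only [Finset.card_empty]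
      omega
    · simp only [Finset.biUnion_empty, Finset.union_empty, Finset.card_insert_of_notMem hj₀S,
        Finset.card_empty]
      omega
  | insert l A hl ih =>
    obtain ⟨W', hWW', hmem, hrank, hcount⟩ := ih
    set U := R l \ S with hU
    have hpU : col j₀ ∈ W ⊔ Submodule.span F (col '' (U : Set ι)) := by
      refine Submodule.span_le.2 ?_ (hspan l)
      rintro _ ⟨j, hj, rfl⟩
      by_cases hjS : j ∈ S
      · exact Submodule.mem_sup_left ((hS j).1 hjS)
      · exact Submodule.mem_sup_right
          (Submodule.subset_span ⟨j, by simpa [hU, hjS] using hj, rfl⟩)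
    have hstep := finrank_sup_span_image_succ_le hWW' hj₀
      (hmem j₀ (Finset.mem_insert_self _ _)) col U hpU
    have hUcard : U.card ≤ 2 := (Finset.card_le_card Finset.sdiff_subset).trans (hcard l)
    have hT : insert j₀ (S ∪ (insert l A).biUnion R) = insert j₀ (S ∪ A.biUnion R) ∪ U := by
      ext j
      simp only [Finset.biUnion_insert, Finset.mem_insert, Finset.mem_union, hU,
        Finset.mem_sdiff]
      tauto
    have hUT : Disjoint (insert j₀ (S ∪ A.biUnion R)) U := by
      rw [Finset.disjoint_right]
      intro j hj hj'
      rw [hU, Finset.mem_sdiff] at hj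
      simp only [Finset.mem_insert, Finset.mem_union, Finset.mem_biUnion] at hj'
      rcases hj' with rfl | hj' | ⟨l', hl', hj'⟩
      · exact hj₀R l hj.1
      · exact hj.2 hj'
      · exact Finset.disjoint_left.1 (hdisj l l' fun h => hl (h ▸ hl')) hj.1 hj'
    refine ⟨W' ⊔ Submodule.span F (col '' (U : Set ι)), hWW'.trans le_sup_left, ?_, ?_, ?_⟩
    · intro j hj
      rw [hT, Finset.mem_union] at hj
      rcases hj with hj | hj
      · exact Submodule.mem_sup_left (hmem j hj)
      · exact Submodule.mem_sup_right (Submodule.subset_span ⟨j, hj, rfl⟩)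
    · rw [Finset.card_insert_of_notMem hl]
      omega
    · rw [Finset.card_insert_of_notMem hl, hT, Finset.card_union_of_disjoint hUT]
      omega

/-- A proper subspace of functionals on `F^k` vanishes at some nonzero vector. -/
theorem exists_ne_zero_of_finrank_dual_lt {F : Type} [Field F] {k : ℕ}
    (W : Submodule F (Module.Dual F (Fin k → F))) (hW : Module.finrank F W < k) :
    ∃ x : Fin k → F, ∃ i, x i ≠ 0 ∧ ∀ f ∈ W, f x = 0 := by
  have h := Subspace.finrank_add_finrank_dualCoannihilator_eq W
  rw [Module.finrank_fin_fun] at h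
  have hne : W.dualCoannihilator ≠ ⊥ := by
    intro h0
    rw [h0, finrank_bot] at h
    omega
  obtain ⟨x, hx, hx0⟩ := Submodule.exists_mem_ne_zero_of_ne_bot hne
  obtain ⟨i, hi⟩ := Function.ne_iff.1 hx0
  exact ⟨x, i, hi, fun f hf => (Submodule.mem_dualCoannihilator x).1 hx f hf⟩

/-- Among `t + 1` disjoint sets, at least `t` avoid a given point. -/
theorem exists_disjoint_family_avoiding {ι : Type} {t : ℕ} (R : Fin (t + 1) → Finset ι)
    (hdisj : ∀ l₁ l₂, l₁ ≠ l₂ → Disjoint (R l₁) (R l₂)) (j : ι) :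
    ∃ l₀ : Fin (t + 1), ∀ l : Fin t, j ∉ R (l₀.succAbove l) := by
  by_cases h : ∃ l₀, j ∈ R l₀
  · obtain ⟨l₀, hl₀⟩ := h
    exact ⟨l₀, fun l hl =>
      Finset.disjoint_left.1 (hdisj _ _ (Fin.succAbove_ne l₀ l)) hl hl₀⟩
  · push Not at h
    exact ⟨0, fun l => h _⟩

open Classical in
/-- Greedy construction of a hyperplane of functionals that contains many coordinates of a
systematic PIR code. -/
theorem exists_hyperplane_of_isPIRCode {F : Type} [Field F] {k n t : ℕ}
    {C : (Fin k → F) →ₗ[F] (Fin n → F)} (hsys : IsSystematic C) (hC : IsPIRCode 2 (t + 1) C)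
    (s : ℕ) (W : Submodule F (Module.Dual F (Fin k → F))) (hW : Module.finrank F W + s + 1 = k) :
    ∃ W' : Submodule F (Module.Dual F (Fin k → F)), Module.finrank F W' + 1 = k ∧
      (Finset.univ.filter fun j => (LinearMap.proj j).comp C ∈ W).card + s + t * s / (t + 1) ≤
        (Finset.univ.filter fun j => (LinearMap.proj j).comp C ∈ W').card := by
  induction s using Nat.strong_induction_on generalizing W with
  | _ s ih =>
    rcases Nat.eq_zero_or_pos s with rfl | hs
    · exact ⟨W, by omega, by simp⟩
    obtain ⟨x, i, hxi, hxW⟩ := exists_ne_zero_of_finrank_dual_lt W (by omega)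
    obtain ⟨R, hdisj, hcard, hrec⟩ := hC.2 i
    have hin := (hsys x i).choose
    have hcol : (LinearMap.proj ⟨i, hin⟩).comp C = (LinearMap.proj i : Module.Dual F _) := by
      ext1 y
      ext
      exact (hsys _ i).choose_spec
    obtain ⟨l₀, hl₀⟩ := exists_disjoint_family_avoiding R hdisj ⟨i, hin⟩
    obtain ⟨A, -, hA⟩ := Finset.exists_subset_card_eq
      (s := (Finset.univ : Finset (Fin t))) (n := min (s - 1) t) (by simp)
    obtain ⟨W', hWW', hmem, hrank, hcount⟩ := exists_extension_by_recovery_sets W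
      (fun j => (LinearMap.proj j).comp C) (j₀ := ⟨i, hin⟩)
      (by
        intro h
        rw [hcol] at h
        exact hxi (hxW _ h))
      (Finset.univ.filter fun j => (LinearMap.proj j).comp C ∈ W) (by simp)
      (fun l => R (l₀.succAbove l))
      (fun l₁ l₂ h => hdisj _ _ fun h' => h (Fin.succAbove_right_injective h'))
      hl₀ (fun l => hcard _)
      (fun l => by
        simp only [hcol]
        exact (hrec _).proj_mem_span) A
    have hlt : Module.finrank F W < Module.finrank F W' := by
      refine Submodule.finrank_lt_finrank_of_lt (lt_of_le_of_ne hWW' ?_)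
      rintro rfl
      have := hmem ⟨i, hin⟩ (Finset.mem_insert_self _ _)
      rw [hcol] at this
      exact hxi (hxW _ this)
    have hsub := Finset.card_le_card (fun j hj => Finset.mem_filter.2
      ⟨Finset.mem_univ j, hmem j hj⟩ : _ ⊆ Finset.univ.filter
        fun j => (LinearMap.proj j).comp C ∈ W')
    obtain ⟨s', hs'⟩ : ∃ s', Module.finrank F W' + s' + 1 = k :=
      ⟨k - 1 - Module.finrank F W', by omega⟩
    obtain ⟨W'', hW'', hcount'⟩ := ih s' (by omega) W' hs'
    refine ⟨W'', hW'', ?_⟩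
    have hf : t * s / (t + 1) ≤ min (s - 1) t + t * s' / (t + 1) := by
      rcases le_total (s - 1) t with h | h
      · rw [min_eq_left h]
        refine le_trans ?_ (Nat.le_add_right _ _)
        have : t * s / (t + 1) < s := by
          rw [Nat.div_lt_iff_lt_mul (by omega)]
          nlinarith
        omega
      · rw [min_eq_right h, ← Nat.mul_add_div (by omega)]
        refine Nat.div_le_div_right ?_
        have : s ≤ s' + (t + 1) := by omega
        calc t * s ≤ t * (s' + (t + 1)) := Nat.mul_le_mul_left _ this
          _ = (t + 1) * t + t * s' := by ring
    omega

/-- Lower bound on the length of a systematic PIR code with recovery sets of size at most two. -/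
theorem IsPIRCode.length_lower_bound {F : Type} [Field F] {k n t : ℕ} (hk : 0 < k)
    {C : (Fin k → F) →ₗ[F] (Fin n → F)} (hsys : IsSystematic C) (hC : IsPIRCode 2 (t + 1) C) :
    k + t + t * (k - 1) / (t + 1) ≤ n := by
  classical
  obtain ⟨W, hW, hcount⟩ := exists_hyperplane_of_isPIRCode hsys hC (k - 1) ⊥ (by
    rw [finrank_bot]
    omega)
  obtain ⟨x, i, hxi, hxW⟩ := exists_ne_zero_of_finrank_dual_lt W (by omega)
  obtain ⟨R, hdisj, -, hrec⟩ := hC.2 i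
  have hex : ∀ l, ∃ j ∈ R l, C x j ≠ 0 := by
    intro l
    by_contra! h
    exact hxi (hrec l x 0 fun j hj => by simpa using h j hj)
  choose g hgR hg using hex
  have hinj : Function.Injective g := by
    intro l₁ l₂ h
    by_contra hne
    exact Finset.disjoint_left.1 (hdisj l₁ l₂ hne) (hgR l₁) (h ▸ hgR l₂)
  have hdis : Disjoint (Finset.univ.filter fun j => (LinearMap.proj j).comp C ∈ W)
      (Finset.univ.image g) := by
    rw [Finset.disjoint_right]
    intro j hj hj'
    obtain ⟨l, -, rfl⟩ := Finset.mem_image.1 hj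
    exact hg l (hxW _ (Finset.mem_filter.1 hj').2)
  have h := Finset.card_le_univ ((Finset.univ.filter
    fun j => (LinearMap.proj j).comp C ∈ W) ∪ Finset.univ.image g)
  rw [Finset.card_union_of_disjoint hdis, Finset.card_image_of_injective _ hinj,
    Finset.card_univ, Fintype.card_fin, Fintype.card_fin] at h
  omega

/-- The systematic encoding with one parity bit `x_{u e} + x_{v e}` for each edge `e`. -/
def graphEncoding (F : Type) [Field F] {k m : ℕ} (u v : Fin m → Fin k) :
    (Fin k → F) →ₗ[F] (Fin (k + m) → F) where
  toFun x := Fin.append x fun e => x (u e) + x (v e)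
  map_add' x y := by
    ext j
    refine Fin.addCases (fun i => ?_) (fun e => ?_) j
    · simp
    · simp only [Fin.append_right, Pi.add_apply]
      ring
  map_smul' c x := by
    ext j
    refine Fin.addCases (fun i => ?_) (fun e => ?_) j
    · simp
    · simp only [Fin.append_right, Pi.smul_apply, smul_eq_mul, RingHom.id_apply]
      ring

theorem isSystematic_graphEncoding (F : Type) [Field F] {k m : ℕ} (u v : Fin m → Fin k) :
    IsSystematic (graphEncoding F u v) := fun x i =>
  ⟨Nat.lt_add_right m i.2, Fin.append_left x (fun e => x (u e) + x (v e)) i⟩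

/-- If every vertex has `t` distinct neighbours, then the graph encoding is a PIR code. -/
theorem isPIRCode_graphEncoding (F : Type) [Field F] {k m t : ℕ} (u v : Fin m → Fin k)
    (N : Fin k → Fin t → Fin k) (hinj : ∀ i, Function.Injective (N i)) (hne : ∀ i l, N i l ≠ i)
    (hedge : ∀ i l, ∃ e, u e = i ∧ v e = N i l ∨ u e = N i l ∧ v e = i) :
    IsPIRCode 2 (t + 1) (graphEncoding F u v) := by
  have hleft : ∀ x i, graphEncoding F u v x (Fin.castAdd m i) = x i := fun x i =>
    Fin.append_left x (fun e => x (u e) + x (v e)) i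
  have hright : ∀ x e, graphEncoding F u v x (Fin.natAdd k e) = x (u e) + x (v e) := fun x e =>
    Fin.append_right x (fun e => x (u e) + x (v e)) e
  refine ⟨fun x y h => funext fun i => by rw [← hleft x, ← hleft y, h], fun i => ?_⟩
  choose e he using hedge i
  have hcross : ∀ (a : Fin k) (b : Fin m), Fin.castAdd m a ≠ Fin.natAdd k b := by
    intro a b h
    have := congrArg Fin.val h
    simp only [Fin.val_castAdd, Fin.val_natAdd] at this
    omega
  have heinj : Function.Injective e := by
    intro l₁ l₂ h
    apply hinj i
    have h₁ := he l₁
    have h₂ := he l₂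
    rw [← h] at h₂
    have := hne i l₁
    have := hne i l₂
    grind
  refine ⟨Fin.cons {Fin.castAdd m i} fun l => {Fin.castAdd m (N i l), Fin.natAdd k (e l)},
    ?_, ?_, ?_⟩
  · intro l₁ l₂
    refine Fin.cases ?_ (fun a => ?_) l₁ <;> refine Fin.cases ?_ (fun b => ?_) l₂ <;> intro h
    · exact absurd rfl h
    · simp [hcross, (hne i b).symm]
    · simp [hcross, (hne i a).symm]
    · have hab : a ≠ b := fun h' => h (by rw [h'])
      simp [hcross, (hcross _ _).symm, (hinj i).eq_iff, heinj.eq_iff, hab.symm]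
  · intro l
    refine Fin.cases ?_ (fun a => ?_) l
    · simp
    · exact Finset.card_le_two
  · intro l
    refine Fin.cases ?_ (fun a => ?_) l
    · intro x y h
      simpa [hleft] using h
    · intro x y h
      simp only [Fin.cons_succ, Finset.mem_insert, Finset.mem_singleton, forall_eq_or_imp,
        forall_eq, hleft, hright] at h
      obtain ⟨h₁, h₂⟩ := h
      rcases he a with ⟨hu, hv⟩ | ⟨hu, hv⟩
      · rw [hu, hv, h₁] at h₂
        exact add_right_cancel h₂
      · rw [hu, hv, h₁] at h₂
        exact add_left_cancel h₂

/-- Addition on `{0, …, k - 1}` modulo `k`. -/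
def wrapAdd {k : ℕ} (i : Fin k) (o : ℕ) (ho : o < k) : Fin k :=
  if h : i + o < k then ⟨i + o, h⟩ else ⟨i + o - k, by omega⟩

theorem val_wrapAdd {k : ℕ} (i : Fin k) (o : ℕ) (ho : o < k) :
    (wrapAdd i o ho : ℕ) = if i + o < k then i + o else i + o - k := by
  unfold wrapAdd
  split <;> rfl

/-- A graph on `k` vertices with `⌈t k / 2⌉` edges in which every vertex has `t` neighbours. -/
theorem exists_graph_neighbours {k t : ℕ} (htk : t < k) :
    ∃ (u v : Fin ((t * k + 1) / 2) → Fin k) (N : Fin k → Fin t → Fin k),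
      (∀ i, Function.Injective (N i)) ∧ (∀ i l, N i l ≠ i) ∧
      ∀ i l, ∃ e, u e = i ∧ v e = N i l ∨ u e = N i l ∧ v e = i := by
  have hk : 0 < k := by omega
  set d := t / 2 with hd
  have hm : d * k ≤ (t * k + 1) / 2 := by
    have : d * 2 ≤ t := Nat.div_mul_le_self t 2
    rw [Nat.le_div_iff_mul_le (by omega)]
    nlinarith
  have hm' : t = 2 * d + 1 → (t * k + 1) / 2 = d * k + (k + 1) / 2 := by
    intro h
    have : t * k = 2 * (d * k) + k := by
      rw [h]
      ring
    omega
  let off : Fin k → Fin t → ℕ := fun i l =>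
    if (l : ℕ) = 2 * d then (if i + k / 2 < k then k / 2 else k - k / 2)
    else if (l : ℕ) % 2 = 0 then l / 2 + 1 else k - (l / 2 + 1)
  have hoff : ∀ i l, 0 < off i l ∧ off i l < k := by
    intro i l
    have := l.2
    simp only [off]
    split_ifs <;> omega
  let dist : Fin ((t * k + 1) / 2) → ℕ := fun e =>
    if (e : ℕ) / k < d then e / k + 1 else k / 2
  have hdist : ∀ e, dist e < k := by
    intro e
    simp only [dist]
    split_ifs <;> omega
  have hdiv : ∀ a b : ℕ, b < k → (a * k + b) / k = a ∧ (a * k + b) % k = b := by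
    intro a b hb
    rw [mul_comm a k]
    exact ⟨by rw [Nat.mul_add_div hk, Nat.div_eq_of_lt hb, add_zero],
      by rw [Nat.mul_add_mod, Nat.mod_eq_of_lt hb]⟩
  have hlt : ∀ a b : ℕ, a < d → b < k → a * k + b < (t * k + 1) / 2 := by
    intro a b ha hb
    have : (a + 1) * k ≤ d * k := Nat.mul_le_mul_right _ ha
    rw [add_mul] at this
    omega
  refine ⟨fun e => ⟨e % k, Nat.mod_lt _ hk⟩,
    fun e => wrapAdd ⟨e % k, Nat.mod_lt _ hk⟩ (dist e) (hdist e),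
    fun i l => wrapAdd i (off i l) (hoff i l).2, ?_, ?_, ?_⟩
  · intro i l₁ l₂ h
    have h' := congrArg Fin.val h
    simp only [val_wrapAdd] at h'
    have h₁ := hoff i l₁
    have h₂ := hoff i l₂
    have hoo : off i l₁ = off i l₂ := by
      split_ifs at h' <;> omega
    have := l₁.2
    have := l₂.2
    ext
    simp only [off] at hoo
    split_ifs at hoo <;> omega
  · intro i l h
    have h' := congrArg Fin.val h
    simp only [val_wrapAdd] at h'
    have := hoff i l
    split_ifs at h' <;> omega
  · intro i l
    have hl := l.2
    have hi := i.2
    beta_reduce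
    set j := wrapAdd i (off i l) (hoff i l).2
    have hjv : (j : ℕ) = if i + off i l < k then i + off i l else i + off i l - k :=
      val_wrapAdd _ _ _
    have hjk := j.2
    clear_value j
    by_cases hlast : (l : ℕ) = 2 * d
    · have ht : t = 2 * d + 1 := by omega
      have hme := hm' ht
      simp only [off, hlast, if_true] at hjv
      by_cases hik : i + k / 2 < k
      · obtain ⟨hq, hr⟩ := hdiv d i hi
        refine ⟨⟨d * k + i, by omega⟩, Or.inl ⟨by ext; exact hr, ?_⟩⟩
        ext
        simp only [val_wrapAdd, dist, hq, hr, lt_irrefl, if_false]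
        simp only [hik, if_true] at hjv ⊢
        exact hjv.symm
      · obtain ⟨hq, hr⟩ := hdiv d j hjk
        simp only [hik, if_false] at hjv
        have hjv' : (j : ℕ) + k / 2 = i := by
          split_ifs at hjv <;> omega
        refine ⟨⟨d * k + j, by omega⟩, Or.inr ⟨by ext; exact hr, ?_⟩⟩
        ext
        simp only [val_wrapAdd, dist, hq, hr, lt_irrefl, if_false]
        split_ifs <;> omega
    · have hld : (l : ℕ) / 2 < d := by omega
      simp only [off, hlast, if_false] at hjv
      by_cases hpar : (l : ℕ) % 2 = 0
      · obtain ⟨hq, hr⟩ := hdiv (l / 2) i hi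
        refine ⟨⟨l / 2 * k + i, hlt _ _ hld hi⟩, Or.inl ⟨by ext; exact hr, ?_⟩⟩
        ext
        simp only [val_wrapAdd, dist, hq, hr, hld, if_true]
        simp only [hpar, if_true] at hjv
        exact hjv.symm
      · obtain ⟨hq, hr⟩ := hdiv (l / 2) j hjk
        refine ⟨⟨l / 2 * k + j, hlt _ _ hld hjk⟩, Or.inr ⟨by ext; exact hr, ?_⟩⟩
        ext
        simp only [val_wrapAdd, dist, hq, hr, hld, if_true]
        simp only [hpar, if_false] at hjv
        split_ifs at hjv ⊢ <;> omega

/-- Bounds on the optimal length `P(k,2,t)` of systematic linear binary PIR codes with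
`r = 2` and `3 ≤ t ≤ max {⌈k/2⌉, 2} + 2`:
`k + t − 2 + ⌈((t−1)(k−1)+1)/t⌉ ≤ P(k,2,t) ≤ k + ⌈(t−1)k/2⌉`. -/
theorem pir_length_bounds_r_two (k t : ℕ) (hk : 4 ≤ k) (ht : 3 ≤ t)
    (htu : t ≤ max ((k + 1) / 2) 2 + 2) :
    k + t - 2 + ((t - 1) * (k - 1) + 1 + (t - 1)) / t ≤
      sInf {n : ℕ | ∃ C : (Fin k → ZMod 2) →ₗ[ZMod 2] (Fin n → ZMod 2),
        IsSystematic C ∧ IsPIRCode 2 t C} ∧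
    sInf {n : ℕ | ∃ C : (Fin k → ZMod 2) →ₗ[ZMod 2] (Fin n → ZMod 2),
        IsSystematic C ∧ IsPIRCode 2 t C} ≤ k + ((t - 1) * k + 1) / 2 := by
  obtain ⟨t, rfl⟩ : ∃ t', t = t' + 1 := ⟨t - 1, by omega⟩
  simp only [Nat.add_sub_cancel]
  obtain ⟨u, v, N, hinj, hne, hedge⟩ := exists_graph_neighbours (k := k) (t := t) (by omega)
  have hmem : k + (t * k + 1) / 2 ∈
      {n : ℕ | ∃ C : (Fin k → ZMod 2) →ₗ[ZMod 2] (Fin n → ZMod 2),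
        IsSystematic C ∧ IsPIRCode 2 (t + 1) C} :=
    ⟨graphEncoding (ZMod 2) u v, isSystematic_graphEncoding _ u v,
      isPIRCode_graphEncoding _ u v N hinj hne hedge⟩
  refine ⟨le_csInf ⟨_, hmem⟩ ?_, Nat.sInf_le hmem⟩
  rintro n ⟨C, hsys, hC⟩
  have h := hC.length_lower_bound (by omega) hsys
  have hdiv : (t * (k - 1) + 1 + t) / (t + 1) = t * (k - 1) / (t + 1) + 1 := by
    rw [add_assoc, add_comm 1 t, Nat.add_div_right _ (by omega)]
  rw [hdiv]
  omega
end

section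
/- Let C be a linear (n,k,r,t) batch code over a finite field F_q with minimum distance d, and suppose n − tr ≥ d and k > tr − (t−1). Then there exists a linear code over F_q of length n − tr, dimension at least k − tr + (t−1), and minimum distance at least d; equivalently, k ≤ tr − (t−1) + k_q^opt(n − tr, d). -/
/-- Hamming weight of a vector: the number of nonzero coordinates. -/
noncomputable def wt {F : Type} [Field F] {ι : Type} (y : ι → F) : ℕ :=
  Nat.card {j : ι // y j ≠ 0}

/-- The linear code `C` has minimum distance (= minimum nonzero weight) exactly `d`. -/
def HasMinDist {F : Type} [Field F] {k n : ℕ}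
    (C : (Fin k → F) →ₗ[F] (Fin n → F)) (d : ℕ) : Prop :=
  (∀ x : Fin k → F, x ≠ 0 → d ≤ wt (C x)) ∧ ∃ x : Fin k → F, x ≠ 0 ∧ wt (C x) = d

/-- `kopt F n d` is the largest dimension of a linear code of length `n` over `F` whose
minimum distance is at least `d` (Cadambe–Mazumdar's `k_q^opt(n,d)` for `q = |F|`). -/
noncomputable def kopt (F : Type) [Field F] (n d : ℕ) : ℕ :=
  sSup {k : ℕ | ∃ C : (Fin k → F) →ₗ[F] (Fin n → F),
    Function.Injective C ∧ ∀ x : Fin k → F, x ≠ 0 → d ≤ wt (C x)}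

/-- Every recovery set contains a coordinate that vanishes as soon as the recovered symbol and all
other coordinates of the set vanish. -/
theorem IsRecoverySet.exists_determined {F : Type} [Field F] {k : ℕ} {ι : Type} [DecidableEq ι]
    {C : (Fin k → F) →ₗ[F] (ι → F)} {i : Fin k} {R : Finset ι} (h : IsRecoverySet C i R) :
    ∃ j ∈ R, ∀ x, (∀ m ∈ R, m ≠ j → C x m = 0) → x i = 0 → C x j = 0 := by
  induction R using Finset.strongInduction with
  | H R ih =>
    by_cases hred : ∃ j ∈ R, IsRecoverySet C i (R.erase j)
    · obtain ⟨j, hj, hrec⟩ := hred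
      obtain ⟨j', hj', hx⟩ := ih _ (Finset.erase_ssubset hj) hrec
      exact ⟨j', Finset.mem_of_mem_erase hj', fun x h0 ↦
        hx x fun m hm ↦ h0 m (Finset.mem_of_mem_erase hm)⟩
    · push Not at hred
      obtain ⟨j, hj⟩ : R.Nonempty := by
        by_contra hR
        rw [Finset.not_nonempty_iff_eq_empty] at hR
        subst hR
        simpa using h (Pi.single i 1) 0 (by simp)
      refine ⟨j, hj, fun x h0 hxi ↦ ?_⟩
      by_contra hxj
      refine hred j hj fun y y' hy ↦ ?_
      have key := h y (y' + ((C y j - C y' j) / C x j) • x) fun m hm ↦ by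
        by_cases hmj : m = j
        · subst hmj
          simp [hxj]
        · simp [h0 m hm hmj, hy m (Finset.mem_erase.2 ⟨hmj, hm⟩)]
      simpa [hxi] using key

theorem wt_comp_of_eq_zero {F : Type} [Field F] {ι κ : Type} {f : κ → ι}
    (hf : Function.Injective f) {y : ι → F} (hy : ∀ j, j ∉ Set.range f → y j = 0) :
    wt (y ∘ f) = wt y := by
  refine Nat.card_congr (Equiv.ofBijective (fun j ↦ ⟨f j.1, j.2⟩) ⟨fun a b hab ↦ ?_, ?_⟩)
  · exact Subtype.ext (hf (congrArg Subtype.val hab))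
  · rintro ⟨j, hj⟩
    obtain ⟨m, rfl⟩ := not_imp_comm.1 (hy j) hj
    exact ⟨⟨m, hj⟩, rfl⟩

/-- Shortening a code at a set `S` of coordinates whose vanishing is implied by vanishing on `T`
costs at most `T.card` dimensions. -/
theorem exists_shortened_code {F : Type} [Field F] {n k d : ℕ}
    (C : (Fin k → F) →ₗ[F] (Fin n → F)) (hinj : Function.Injective C)
    (hd : ∀ x, x ≠ 0 → d ≤ wt (C x)) (S T : Finset (Fin n))
    (hST : ∀ x, (∀ j ∈ T, C x j = 0) → ∀ j ∈ S, C x j = 0) :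
    ∃ k' : ℕ, k - T.card ≤ k' ∧ ∃ C' : (Fin k' → F) →ₗ[F] (Fin (n - S.card) → F),
      Function.Injective C' ∧ ∀ x, x ≠ 0 → d ≤ wt (C' x) := by
  let P : (Fin k → F) →ₗ[F] (T → F) := LinearMap.funLeft F F Subtype.val ∘ₗ C
  let E : (Fin (Module.finrank F (LinearMap.ker P)) → F) ≃ₗ[F] LinearMap.ker P :=
    (Module.finBasis F (LinearMap.ker P)).equivFun.symm
  have hcompl : Sᶜ.card = n - S.card := by simp [Finset.card_compl]
  let e : Fin (n - S.card) ≃ {j // j ∈ Sᶜ} := (Sᶜ.equivFinOfCardEq hcompl).symm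
  let f : Fin (n - S.card) → Fin n := fun m ↦ (e m).1
  have hf : Function.Injective f := Subtype.val_injective.comp e.injective
  have hzero (x) (j : Fin n) (hj : j ∉ Set.range f) : C (E x) j = 0 := by
    refine hST _ (fun m hm ↦ congrFun (LinearMap.mem_ker.1 (E x).2) ⟨m, hm⟩) j ?_
    by_contra hjS
    exact hj ⟨e.symm ⟨j, Finset.mem_compl.2 hjS⟩, by simp [f]⟩
  refine ⟨_, ?_, LinearMap.funLeft F F f ∘ₗ C ∘ₗ (LinearMap.ker P).subtype ∘ₗ E.toLinearMap,
    ?_, fun x hx ↦ ?_⟩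
  · have hrank := P.finrank_range_add_finrank_ker
    have hle := (LinearMap.range P).finrank_le
    simp only [Module.finrank_fintype_fun_eq_card, Fintype.card_fin, Fintype.card_coe] at hrank hle
    omega
  · rw [injective_iff_map_eq_zero]
    intro x hx
    have hCx : C (E x) = 0 := by
      ext j
      by_cases hj : j ∈ Set.range f
      · obtain ⟨m, rfl⟩ := hj
        exact congrFun hx m
      · exact hzero x j hj
    simpa using (injective_iff_map_eq_zero C).1 hinj _ hCx
  · exact (hd _ (by simpa using hx)).trans_eq (wt_comp_of_eq_zero hf (hzero x)).symm

theorem le_kopt {F : Type} [Field F] {n k d : ℕ} (C : (Fin k → F) →ₗ[F] (Fin n → F))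
    (hinj : Function.Injective C) (hd : ∀ x, x ≠ 0 → d ≤ wt (C x)) : k ≤ kopt F n d := by
  refine le_csSup ⟨n, ?_⟩ ⟨C, hinj, hd⟩
  rintro m ⟨C', hC', -⟩
  simpa using LinearMap.finrank_le_finrank_of_injective hC'

/-- In a batch code of positive dimension, some `t * r` coordinates are determined, as far as
vanishing is concerned, by `t * r - (t - 1)` among them. -/
theorem IsBatchCode.exists_dependent_coordinates {F : Type} [Field F] {n k r t : ℕ}
    {C : (Fin k → F) →ₗ[F] (Fin n → F)} (hC : IsBatchCode r t C) (ht : 1 ≤ t)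
    (hn : t * r ≤ n) (i : Fin k) :
    ∃ S T : Finset (Fin n), S.card = t * r ∧ T.card = t * r - (t - 1) ∧
      ∀ x, (∀ j ∈ T, C x j = 0) → ∀ j ∈ S, C x j = 0 := by
  obtain ⟨R, hdisj, hcard, hrec⟩ := hC.2 fun _ ↦ i
  choose J hJR hJ using fun l ↦ (hrec l).exists_determined
  have hJeq {l m : Fin t} (h : J l ∈ R m) : l = m := by
    by_contra hlm
    exact Finset.disjoint_left.1 (hdisj l m hlm) (hJR l) h
  have hJinj : Function.Injective J := fun l m h ↦ hJeq (h ▸ hJR m)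
  have hunion : (Finset.univ.biUnion R).card ≤ t * r := by
    simpa using Finset.card_biUnion_le_card_mul Finset.univ R r fun l _ ↦ hcard l
  obtain ⟨S, hRS, hS⟩ := Finset.exists_superset_card_eq hunion (by simpa using hn)
  have hsub (l : Fin t) : R l ⊆ S :=
    (Finset.subset_biUnion_of_mem R (Finset.mem_univ l)).trans hRS
  let l₀ : Fin t := ⟨0, ht⟩
  let D := (Finset.univ.erase l₀).image J
  have hD {l m} (hm : m ∈ R l) (hml : m ≠ J l) : m ∉ D := by
    intro h
    obtain ⟨l', -, rfl⟩ := Finset.mem_image.1 h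
    exact hml (congrArg J (hJeq hm))
  refine ⟨S, S \ D, hS, ?_, fun x hx j hj ↦ ?_⟩
  · rw [Finset.card_sdiff_of_subset, hS, Finset.card_image_of_injective _ hJinj]
    · simp
    · exact Finset.image_subset_iff.2 fun l _ ↦ hsub l (hJR l)
  · have hxi : x i = 0 := hrec l₀ x 0 fun m hm ↦ by
      have hmD : m ∉ D := by
        intro h
        obtain ⟨l, hl, rfl⟩ := Finset.mem_image.1 h
        exact (Finset.mem_erase.1 hl).1 (hJeq hm)
      simpa using hx m (Finset.mem_sdiff.2 ⟨hsub l₀ hm, hmD⟩)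
    by_cases hjD : j ∈ D
    · obtain ⟨l, -, rfl⟩ := Finset.mem_image.1 hjD
      exact hJ l x (fun m hm hml ↦ hx m (Finset.mem_sdiff.2 ⟨hsub l hm, hD hm hml⟩)) hxi
    · exact hx j (Finset.mem_sdiff.2 ⟨hj, hjD⟩)

/-- Cadambe–Mazumdar-type bound for batch codes: if `C` is a linear `(n,k,r,t)` batch
code over a finite field `F` with minimum distance `d`, `n − tr ≥ d` and
`k > tr − (t−1)`, then there is a linear code over `F` of length `n − tr`, dimension at
least `k − (tr − (t−1))` and minimum distance at least `d`; equivalently,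
`k ≤ tr − (t−1) + k_q^opt(n − tr, d)`. -/
theorem batch_dimension_bound {F : Type} [Field F] [Fintype F] {n k r t d : ℕ}
    (ht : 1 ≤ t) (C : (Fin k → F) →ₗ[F] (Fin n → F)) (hC : IsBatchCode r t C)
    (hd : HasMinDist C d) (hn : t * r + d ≤ n) (hk : t * r - (t - 1) < k) :
    (∃ k' : ℕ, k - (t * r - (t - 1)) ≤ k' ∧
      ∃ C' : (Fin k' → F) →ₗ[F] (Fin (n - t * r) → F),
        Function.Injective C' ∧ ∀ x : Fin k' → F, x ≠ 0 → d ≤ wt (C' x)) ∧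
    k ≤ t * r - (t - 1) + kopt F (n - t * r) d := by
  obtain ⟨S, T, hS, hT, hST⟩ :=
    hC.exists_dependent_coordinates ht (by omega) ⟨0, by omega⟩
  have hcode := exists_shortened_code C hC.1 hd.1 S T hST
  rw [hS, hT] at hcode
  obtain ⟨k', hk', C', hinj, hC'⟩ := hcode
  have := le_kopt C' hinj hC'
  exact ⟨⟨k', hk', C', hinj, hC'⟩, by omega⟩
end

section
/- Let C be a linear code of length n and dimension k over a finite field F_q, let i ∈ {1,…,k}, and let R_1, …, R_t ⊆ {1,…,n} be pairwise disjoint recovery sets for the coordinate i, each of size at most r. Let I = R_1 ∪ R_2 ∪ … ∪ R_t. Then the number of distinct restrictions to I of codewords of C is at most q^{|I| − (t−1)}; in particular, it is at most q^{tr − (t−1)}. -/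
/-- A recovery set contains a coordinate that is determined by the other coordinates of the set
together with the recovered information symbol. -/
theorem IsRecoverySet.exists_mem_determined {F : Type} [Field F] {k : ℕ} {ι : Type}
    [DecidableEq ι] {C : (Fin k → F) →ₗ[F] (ι → F)} {i : Fin k} {R : Finset ι}
    (hR : IsRecoverySet C i R) :
    ∃ p ∈ R, ∀ x x' : Fin k → F, (∀ j ∈ R.erase p, C x j = C x' j) → x i = x' i →
      C x p = C x' p := by
  induction R using Finset.induction_on with
  | empty =>
    exact absurd (hR 0 (fun _ => 1) (by simp)) (by simp)
  | insert a s ha ih =>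
    by_cases hs : IsRecoverySet C i s
    · obtain ⟨p, hp, hdet⟩ := ih hs
      refine ⟨p, Finset.mem_insert_of_mem hp, fun x x' hx hi => hdet x x' (fun j hj => ?_) hi⟩
      exact hx j (Finset.erase_subset_erase p (Finset.subset_insert a s) hj)
    · refine ⟨a, Finset.mem_insert_self a s, fun x x' hx hi => ?_⟩
      rw [Finset.erase_insert ha] at hx
      unfold IsRecoverySet at hs
      push Not at hs
      obtain ⟨z, z', hz, hzi⟩ := hs
      by_contra hne
      have hne' : C x a - C x' a ≠ 0 := sub_ne_zero.mpr hne
      have key := hR z (z' + ((C z a - C z' a) / (C x a - C x' a)) • (x - x')) (fun j hj => by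
        rcases Finset.mem_insert.mp hj with rfl | hj
        · simp [div_mul_cancel₀ _ hne']
        · simp [hx j hj, hz j hj])
      exact hzi (by simpa [hi] using key)

/-- If the restriction of a codeword to `J` determines its restriction to `I`, there are at most
`|F| ^ |J|` restrictions to `I`. -/
theorem card_range_restriction_le {F α ι : Type} [Fintype F] (C : α → ι → F) (I J : Finset ι)
    (h : ∀ x x' : α, (∀ j ∈ J, C x j = C x' j) → ∀ j ∈ I, C x j = C x' j) :
    Nat.card ↥(Set.range fun x : α => fun j : {j : ι // j ∈ I} => C x j.val) ≤
      Fintype.card F ^ J.card := by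
  let f : ↥(Set.range fun x : α => fun j : {j : ι // j ∈ I} => C x j.val) → (J → F) :=
    fun y j => C y.2.choose j
  have hf : Function.Injective f := by
    intro y y' hy
    apply Subtype.ext
    rw [← y.2.choose_spec, ← y'.2.choose_spec]
    funext j
    exact h _ _ (fun j hj => congrFun hy ⟨j, hj⟩) j j.2
  refine (Nat.card_le_card_of_injective f hf).trans_eq ?_
  simp [Nat.card_fun]

/-- If `R 0, …, R (t-1)` are pairwise disjoint recovery sets for coordinate `i` of a
linear code `C` over a finite field `F`, each of size at most `r`, and
`I = R 0 ∪ ⋯ ∪ R (t-1)`, then the number of distinct restrictions of codewords to `I` is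
at most `|F| ^ (|I| − (t−1))`, and in particular at most `|F| ^ (tr − (t−1))`. -/
theorem restriction_count_bound {F : Type} [Field F] [Fintype F] {n k r t : ℕ}
    (C : (Fin k → F) →ₗ[F] (Fin n → F)) (hinj : Function.Injective C)
    (i : Fin k) (R : Fin t → Finset (Fin n))
    (hdisj : ∀ l₁ l₂ : Fin t, l₁ ≠ l₂ → Disjoint (R l₁) (R l₂))
    (hcard : ∀ l : Fin t, (R l).card ≤ r)
    (hrec : ∀ l : Fin t, IsRecoverySet C i (R l)) :
    Nat.card ↥(Set.range fun x : Fin k → F =>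
        fun j : {j : Fin n // j ∈ Finset.univ.biUnion R} => C x j.val) ≤
      Fintype.card F ^ ((Finset.univ.biUnion R).card - (t - 1)) ∧
    Nat.card ↥(Set.range fun x : Fin k → F =>
        fun j : {j : Fin n // j ∈ Finset.univ.biUnion R} => C x j.val) ≤
      Fintype.card F ^ (t * r - (t - 1)) := by
  suffices hJ : ∃ J : Finset (Fin n), J.card = (Finset.univ.biUnion R).card - (t - 1) ∧
      ∀ x x' : Fin k → F, (∀ j ∈ J, C x j = C x' j) →
        ∀ j ∈ Finset.univ.biUnion R, C x j = C x' j by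
    obtain ⟨J, hJ, hdet⟩ := hJ
    have hle := card_range_restriction_le (fun x => C x) (Finset.univ.biUnion R) J hdet
    rw [hJ] at hle
    have hI : (Finset.univ.biUnion R).card ≤ t * r := by
      simpa using Finset.card_biUnion_le_card_mul Finset.univ R r fun l _ => hcard l
    exact ⟨hle, hle.trans (Nat.pow_le_pow_right Fintype.card_pos (by omega))⟩
  rcases t with _ | t
  · exact ⟨∅, by simp, by simp⟩
  choose p hp hdet using fun l => (hrec l).exists_mem_determined
  have hmem : ∀ {l l' : Fin (t + 1)} {j : Fin n}, j ∈ R l → j ∈ R l' → l = l' := by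
    intro l l' j hl hl'
    by_contra hne
    exact Finset.disjoint_left.mp (hdisj l l' hne) hl hl'
  have hpinj : Function.Injective p := fun l l' h => hmem (hp l) (h ▸ hp l')
  refine ⟨Finset.univ.biUnion R \ (Finset.univ.erase 0).image p, ?_, ?_⟩
  · rw [Finset.card_sdiff_of_subset, Finset.card_image_of_injective _ hpinj]
    · simp
    · intro j hj
      obtain ⟨l, -, rfl⟩ := Finset.mem_image.mp hj
      exact Finset.mem_biUnion.mpr ⟨l, Finset.mem_univ l, hp l⟩
  · intro x x' hx
    have agree : ∀ l, ∀ j ∈ R l, (l ≠ 0 → j ≠ p l) → C x j = C x' j := by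
      intro l j hj hjp
      refine hx j (Finset.mem_sdiff.mpr
        ⟨Finset.mem_biUnion.mpr ⟨l, Finset.mem_univ l, hj⟩, fun hmem' => ?_⟩)
      obtain ⟨l', hl', rfl⟩ := Finset.mem_image.mp hmem'
      obtain rfl := hmem hj (hp l')
      exact hjp (Finset.ne_of_mem_erase hl') rfl
    have hi : x i = x' i := hrec 0 x x' fun j hj => agree 0 j hj fun h => absurd rfl h
    intro j hj
    obtain ⟨l, -, hjl⟩ := Finset.mem_biUnion.mp hj
    by_cases hjp : j = p l
    · rw [hjp]
      exact hdet l x x' (fun j' hj' => agree l j' (Finset.mem_of_mem_erase hj')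
        fun _ => Finset.ne_of_mem_erase hj') hi
    · exact agree l j hjl fun _ => hjp
end
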